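/- arXiv:2504.11030 — 4 statements merged into one kernel-verified Lean document; each statement's English description precedes it below -/
import Mathlib

section
/- Let φ : Ω → Ω̃ be a homeomorphism between open subsets of X. Then there exists a Borel set S ⊂ Ω with μ(S) = 0 such that: (i) the restriction φ|_{Ω∖S} has the Luzin N-property, i.e. μ(φ(A)) = 0 for every A ⊆ Ω∖S with μ(A) = 0; and (ii) the change of variables formula ∫_E (f∘φ)(x)·φ'_v(x) dμ(x) = ∫_{φ(E∖S)} f(y) dμ(y) holds for every Borel set E ⊆ Ω and every non-negative Borel function f : Ω̃ → [0,∞]. -/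
open MeasureTheory Metric Filter Topology NNReal ENNReal

/-- The volume derivative of a map `φ`, defined on an open set `Ω ⊆ X`, at a point `x`:
the (upper) limit as `r → 0⁺` of `μ(φ(B(x,r)))/μ(B(x,r))`, the image being taken over
radii small enough that `B(x,r) ⊆ Ω` (for small `r` one has `B(x,r) ∩ Ω = B(x,r)`).
It coincides with the genuine limit whenever the latter exists; the limit exists and
is finite `μ`-a.e. in `Ω`. -/
noncomputable def volDeriv {X : Type*} [MetricSpace X] [MeasurableSpace X]
    (μ : Measure X) (Ω : Set X) (φ : X → X) (x : X) : ℝ≥0∞ :=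
  Filter.limsup (fun r : ℝ => μ (φ '' (ball x r ∩ Ω)) / μ (ball x r)) (𝓝[>] 0)

/-- A measure which is globally doubling on open balls is
uniformly locally doubling. -/
theorem isUnifLocDoublingMeasure_of_ball {X : Type*} [MetricSpace X] [MeasurableSpace X]
    {μ : Measure X} {C : ℝ≥0}
    (hdbl : ∀ (x : X) (r : ℝ), 0 < r → μ (ball x (2 * r)) ≤ (C : ℝ≥0∞) * μ (ball x r)) :
    IsUnifLocDoublingMeasure μ := by
  refine ⟨C * C, ?_⟩
  filter_upwards [self_mem_nhdsWithin] with ε (hε : 0 < ε) x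
  calc μ (closedBall x (2 * ε)) ≤ μ (ball x (2 * (2 * ε))) :=
        measure_mono (closedBall_subset_ball (by linarith))
    _ ≤ C * (C * μ (ball x ε)) := (hdbl x _ (by linarith)).trans (by gcongr; exact hdbl x ε hε)
    _ ≤ ↑(C * C) * μ (closedBall x ε) := by
        rw [← mul_assoc, ENNReal.coe_mul]
        gcongr
        exact ball_subset_closedBall

/-- Differentiation along closed balls implies differentiation along open balls. -/
theorem tendsto_measure_ball_div {X : Type*} [MetricSpace X] [MeasurableSpace X]
    {μ ρ : Measure X} {x : X} (hpos : ∀ r : ℝ, 0 < r → 0 < μ (ball x r))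
    (hfin : ∀ r : ℝ, μ (ball x r) < ⊤) {c : ℝ≥0∞}
    (h : Tendsto (fun r => ρ (closedBall x r) / μ (closedBall x r)) (𝓝[>] 0) (𝓝 c)) :
    Tendsto (fun r => ρ (ball x r) / μ (ball x r)) (𝓝[>] 0) (𝓝 c) := by
  refine (closed_nhds_basis c).tendsto_right_iff.2 fun V hV => ?_
  obtain ⟨δ, hδ, hsub⟩ := mem_nhdsGT_iff_exists_Ioo_subset.1 (h hV.1)
  filter_upwards [Ioo_mem_nhdsGT hδ] with r hr
  obtain ⟨u, humono, hu, hlim⟩ := exists_seq_strictMono_tendsto' hr.1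
  have hball : ⋃ n, closedBall x (u n) = ball x r := by
    ext y
    simp only [Set.mem_iUnion, mem_closedBall, mem_ball]
    refine ⟨fun ⟨n, hn⟩ => hn.trans_lt (hu n).2, fun hy => ?_⟩
    exact ((hlim.eventually (lt_mem_nhds hy)).exists).imp fun n hn => hn.le
  have hmono : Monotone fun n => closedBall x (u n) :=
    fun m n hmn => closedBall_subset_closedBall (humono.monotone hmn)
  have key (ν : Measure X) : Tendsto (fun n => ν (closedBall x (u n))) atTop (𝓝 (ν (ball x r))) :=
    hball ▸ tendsto_measure_iUnion_atTop hmono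
  exact hV.2.mem_of_tendsto
    (ENNReal.Tendsto.div (key ρ) (.inr (hpos r hr.1).ne') (key μ) (.inl (hfin r).ne))
    (Eventually.of_forall fun n => hsub ⟨(hu n).1, (hu n).2.trans hr.2⟩)

/-- The pullback of a measure under a map that restricts to an open embedding of `Ω`. -/
theorem exists_pullback_measure {X : Type*} [TopologicalSpace X] [MeasurableSpace X]
    [BorelSpace X] (μ : Measure X) [SigmaFinite μ] {Ω : Set X} (hΩ : IsOpen Ω) {φ : X → X}
    (hφ : IsOpenEmbedding (Ω.domRestrict φ)) :
    ∃ ρ : Measure X, SigmaFinite ρ ∧ (∀ A, MeasurableSet A → ρ A = μ (φ '' (A ∩ Ω))) ∧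
      ∀ E ⊆ Ω, MeasurableSet E → ∀ f : X → ℝ≥0∞, Measurable f →
        ∫⁻ x in E, f (φ x) ∂ρ = ∫⁻ y in φ '' E, f y ∂μ := by
  have hm : MeasurableEmbedding (Ω.domRestrict φ) := hφ.measurableEmbedding
  have hv : MeasurableEmbedding ((↑) : Ω → X) := .subtype_coe hΩ.measurableSet
  have himg (A : Set X) : Ω.domRestrict φ '' ((↑) ⁻¹' A) = φ '' (A ∩ Ω) := by
    ext y
    simp [and_comm]
  have hsig : SigmaFinite (μ.comap (Ω.domRestrict φ)) := by
    refine SigmaFinite.of_map _ hm.measurable.aemeasurable ?_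
    rw [hm.map_comap]
    infer_instance
  refine ⟨(μ.comap (Ω.domRestrict φ)).map (↑), hv.sigmaFinite_map, fun A hA => ?_,
    fun E hE hEm f hf => ?_⟩
  · rw [hv.map_apply, hm.comap_apply, himg]
  · rw [hv.restrict_map, hv.lintegral_map]
    have hEφ : (Ω.domRestrict φ) ⁻¹' (φ '' E) = (↑) ⁻¹' E := by
      rw [← Set.inter_eq_left.2 hE, ← himg, Set.preimage_image_eq _ hm.injective,
        Set.inter_eq_left.2 hE]
    have hsub : φ '' E ⊆ Set.range (Ω.domRestrict φ) := by
      rw [Set.range_domRestrict]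
      exact Set.image_mono hE
    calc ∫⁻ x in (↑) ⁻¹' E, f (φ x) ∂(μ.comap (Ω.domRestrict φ))
        = ∫⁻ y in φ '' E, f y ∂((μ.comap (Ω.domRestrict φ)).map (Ω.domRestrict φ)) := by
          rw [hm.restrict_map, hm.lintegral_map, hEφ]
          rfl
      _ = ∫⁻ y in φ '' E, f y ∂μ := by
          rw [hm.map_comap, Measure.restrict_restrict_of_subset hsub]

/-- The volume derivative is almost everywhere the Radon-Nikodym derivative of the pullback
measure. -/
theorem volDeriv_ae_eq_rnDeriv {X : Type*} [MetricSpace X] [SecondCountableTopology X]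
    [MeasurableSpace X] [BorelSpace X] {μ ρ : Measure X} [IsUnifLocDoublingMeasure μ]
    [IsLocallyFiniteMeasure μ] [SigmaFinite ρ]
    (hpos : ∀ (x : X) (r : ℝ), 0 < r → 0 < μ (ball x r))
    (hfin : ∀ (x : X) (r : ℝ), μ (ball x r) < ⊤)
    {Ω : Set X} {φ : X → X}
    (hρ : ∀ A, MeasurableSet A → ρ A = μ (φ '' (A ∩ Ω)))
    (hloc : ∀ x ∈ Ω, ∃ U, IsOpen U ∧ x ∈ U ∧ ρ U < ⊤) :
    ∀ᵐ x ∂μ, x ∈ Ω → volDeriv μ Ω φ x = ρ.rnDeriv μ x := by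
  refine measure_null_of_locally_null _ fun x hx => ?_
  obtain ⟨hxΩ, -⟩ := Classical.not_imp.1 hx
  obtain ⟨U, hU, hxU, hUfin⟩ := hloc x hxΩ
  refine ⟨U ∩ _,
    Filter.inter_mem (mem_nhdsWithin_of_mem_nhds (hU.mem_nhds hxU)) self_mem_nhdsWithin, ?_⟩
  have : IsFiniteMeasure (ρ.restrict U) := ⟨by simpa using hUfin⟩
  have hae : ∀ᵐ y ∂μ, y ∈ U → volDeriv μ Ω φ y = ρ.rnDeriv μ y := by
    filter_upwards [(IsUnifLocDoublingMeasure.vitaliFamily μ 1).ae_tendsto_rnDeriv (ρ.restrict U),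
      Measure.rnDeriv_restrict ρ μ hU.measurableSet] with y hy hy' hyU
    rw [hy', Set.indicator_of_mem hyU] at hy
    have hball := tendsto_measure_ball_div (hpos y) (hfin y)
      (hy.comp (IsUnifLocDoublingMeasure.tendsto_closedBall_filterAt μ (fun _ => y) id tendsto_id
        (by filter_upwards [self_mem_nhdsWithin] with r (hr : 0 < r); simpa using hr.le)))
    refine (hball.congr' ?_).limsup_eq
    obtain ⟨δ, hδ, hsub⟩ := Metric.isOpen_iff.1 hU y hyU
    filter_upwards [Ioo_mem_nhdsGT hδ] with r hr
    rw [Measure.restrict_apply measurableSet_ball,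
      Set.inter_eq_left.2 ((ball_subset_ball hr.2.le).trans hsub), hρ _ measurableSet_ball]
  refine measure_mono_null ?_ hae
  exact fun y hy h => hy.2 fun _ => h hy.1

/-- Let `φ : Ω → Ω̃` be a homeomorphism between open subsets of `X`.
Then there exists a Borel set `S ⊂ Ω` with `μ(S) = 0` such that (i) the restriction of
`φ` to `Ω ∖ S` has the Luzin N-property, and (ii) the change of variables formula
`∫_E (f∘φ)·φ'_v dμ = ∫_{φ(E∖S)} f dμ` holds for every Borel `E ⊆ Ω` and every
non-negative Borel function `f`. -/
theorem stmt5
    {X : Type*} [MetricSpace X] [CompleteSpace X] [TopologicalSpace.SeparableSpace X]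
    [MeasurableSpace X] [BorelSpace X] (μ : Measure X)
    (hpos : ∀ (x : X) (r : ℝ), 0 < r → 0 < μ (ball x r))
    (hfin : ∀ (x : X) (r : ℝ), μ (ball x r) < ⊤)
    (C_D : ℝ≥0) (hC_D : 1 ≤ C_D)
    (hdbl : ∀ (x : X) (r : ℝ), 0 < r → μ (ball x (2 * r)) ≤ (C_D : ℝ≥0∞) * μ (ball x r))
    (Ω Ω' : Set X) (hΩ : IsOpen Ω) (hΩ' : IsOpen Ω')
    (φ : X → X)
    (hmaps : Set.MapsTo φ Ω Ω') (hinj : Set.InjOn φ Ω) (hsurj : φ '' Ω = Ω')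
    (hcont : ContinuousOn φ Ω)
    (hopenmap : ∀ U : Set X, U ⊆ Ω → IsOpen U → IsOpen (φ '' U)) :
    ∃ S : Set X, S ⊆ Ω ∧ MeasurableSet S ∧ μ S = 0 ∧
      (∀ A : Set X, A ⊆ Ω \ S → μ A = 0 → μ (φ '' A) = 0) ∧
      (∀ E : Set X, E ⊆ Ω → MeasurableSet E → ∀ f : X → ℝ≥0∞, Measurable f →
        ∫⁻ x in E, f (φ x) * volDeriv μ Ω φ x ∂μ = ∫⁻ y in φ '' (E \ S), f y ∂μ) := by
  have : SecondCountableTopology X := UniformSpace.secondCountable_of_separable X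
  have : IsLocallyFiniteMeasure μ := ⟨fun x => ⟨ball x 1, ball_mem_nhds x one_pos, hfin x 1⟩⟩
  have : IsUnifLocDoublingMeasure μ := isUnifLocDoublingMeasure_of_ball hdbl
  have hemb : IsOpenEmbedding (Ω.domRestrict φ) := by
    refine .of_continuous_injective_isOpenMap hcont.domRestrict hinj.injective fun U hU => ?_
    have hUimg : Ω.domRestrict φ '' U = φ '' ((↑) '' U) := by
      rw [Set.image_image]
      rfl
    rw [hUimg]
    exact hopenmap _ (Subtype.coe_image_subset Ω U) (hΩ.isOpenMap_subtype_val U hU)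
  obtain ⟨ρ, hρσ, hρ, hρint⟩ := exists_pullback_measure μ hΩ hemb
  have hloc : ∀ x ∈ Ω, ∃ U, IsOpen U ∧ x ∈ U ∧ ρ U < ⊤ := fun x hx => by
    refine ⟨Ω ∩ φ ⁻¹' ball (φ x) 1, hcont.isOpen_inter_preimage hΩ isOpen_ball,
      ⟨hx, mem_ball_self one_pos⟩, ?_⟩
    rw [hρ _ (hcont.isOpen_inter_preimage hΩ isOpen_ball).measurableSet]
    refine (measure_mono ?_).trans_lt (hfin (φ x) 1)
    rintro _ ⟨y, hy, rfl⟩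
    exact hy.1.2
  have hder := volDeriv_ae_eq_rnDeriv hpos hfin hρ hloc
  obtain ⟨T, hT, hsing, hTμ⟩ := Measure.mutuallySingular_singularPart ρ μ
  have hrestrict : ∀ A ⊆ T, ρ.restrict A = (μ.withDensity (ρ.rnDeriv μ)).restrict A := by
    intro A hAT
    conv_lhs => rw [ρ.haveLebesgueDecomposition_add μ, Measure.restrict_add,
      Measure.restrict_eq_zero.2 (measure_mono_null hAT hsing), zero_add]
  refine ⟨Ω ∩ Tᶜ, Set.inter_subset_left, hΩ.measurableSet.inter hT.compl,
    measure_mono_null Set.inter_subset_right hTμ, fun A hA hA0 => ?_, fun E hE hEm f hf => ?_⟩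
  · have hAT : A ⊆ T := fun x hx => by_contra fun h => (hA hx).2 ⟨(hA hx).1, h⟩
    have hρA : ρ A = 0 := by
      rw [← Measure.restrict_eq_zero, hrestrict A hAT, Measure.restrict_eq_zero]
      exact withDensity_absolutelyContinuous _ _ hA0
    rw [← measure_toMeasurable, hρ _ (measurableSet_toMeasurable _ _)] at hρA
    refine measure_mono_null (Set.image_mono ?_) hρA
    exact Set.subset_inter (subset_toMeasurable _ _) fun x hx => (hA hx).1
  · have hES : E \ (Ω ∩ Tᶜ) ⊆ T := fun x hx => by_contra fun h => hx.2 ⟨hE hx.1, h⟩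
    have hESm : MeasurableSet (E \ (Ω ∩ Tᶜ)) := hEm.diff (hΩ.measurableSet.inter hT.compl)
    have hESμ : (E \ (Ω ∩ Tᶜ) : Set X) =ᵐ[μ] E :=
      sdiff_null_ae_eq_self (measure_mono_null Set.inter_subset_right hTμ)
    rw [← hρint _ (Set.sdiff_subset.trans hE) hESm f hf, hrestrict _ hES,
      restrict_withDensity hESm, lintegral_withDensity_eq_lintegral_mul_non_measurable₀ _
        (Measure.measurable_rnDeriv _ _).aemeasurable
        (ae_restrict_of_ae (Measure.rnDeriv_lt_top ρ μ)),
      Measure.restrict_congr_set hESμ]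
    refine setLIntegral_congr_fun_ae hEm ?_
    filter_upwards [hder] with x hx hxE
    rw [hx (hE hxE), Pi.mul_apply, mul_comm]
end

section
/- Let E ⊆ ℝⁿ be a Lebesgue measurable set and let φ : E → ℝᵐ satisfy limsup_{y→x, y∈E} |φ(y) − φ(x)|/|y − x| < ∞ for almost every x ∈ E. Then for almost every x ∈ E there exists a linear map A : ℝⁿ → ℝᵐ such that for every ε > 0 the set {y ∈ E : |φ(y) − φ(x) − A(y − x)| ≤ ε·|y − x|} has Lebesgue density 1 at x; moreover, at every such point x at which E itself has Lebesgue density 1, the linear map A with this property is unique. -/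
open MeasureTheory Metric Filter Topology

/-- A set `S ⊆ ℝⁿ` has Lebesgue density `1` at the point `x`:
`vol(S ∩ B(x,r))/vol(B(x,r)) → 1` as `r → 0⁺`. -/
def HasLebesgueDensityOne {n : ℕ} (S : Set (EuclideanSpace ℝ (Fin n)))
    (x : EuclideanSpace ℝ (Fin n)) : Prop :=
  Tendsto (fun r : ℝ => volume (S ∩ ball x r) / volume (ball x r)) (𝓝[>] 0) (𝓝 1)

/-- `A` is an approximate differential of `φ` at `x` relative to the set `E`:
for every `ε > 0` the set `{y ∈ E : ‖φ(y) − φ(x) − A(y − x)‖ ≤ ε·‖y − x‖}` has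
Lebesgue density `1` at `x`. -/
def IsApproxFDerivOn {n m : ℕ} (E : Set (EuclideanSpace ℝ (Fin n)))
    (φ : EuclideanSpace ℝ (Fin n) → EuclideanSpace ℝ (Fin m))
    (x : EuclideanSpace ℝ (Fin n))
    (A : EuclideanSpace ℝ (Fin n) →ₗ[ℝ] EuclideanSpace ℝ (Fin m)) : Prop :=
  ∀ ε : ℝ, 0 < ε →
    HasLebesgueDensityOne {y | y ∈ E ∧ ‖φ y - φ x - A (y - x)‖ ≤ ε * ‖y - x‖} x

section Density

variable {n : ℕ} {S T : Set (EuclideanSpace ℝ (Fin n))} {x : EuclideanSpace ℝ (Fin n)}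

theorem hasLebesgueDensityOne_iff_closedBall :
    HasLebesgueDensityOne S x ↔
      Tendsto (fun r : ℝ => volume (S ∩ closedBall x r) / volume (closedBall x r))
        (𝓝[>] 0) (𝓝 1) := by
  refine tendsto_congr' ?_
  filter_upwards [self_mem_nhdsWithin] with r hr
  have hball : (ball x r : Set _) =ᵐ[volume] closedBall x r := by
    rw [← ball_union_sphere]
    exact (union_ae_eq_left_of_ae_eq_empty
      (ae_eq_empty.2 (Measure.addHaar_sphere_of_ne_zero volume x (ne_of_gt hr)))).symm
  rw [measure_congr hball, measure_congr ((ae_eq_refl S).inter hball)]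

theorem volume_inter_ball_div_le_one (S : Set (EuclideanSpace ℝ (Fin n)))
    (x : EuclideanSpace ℝ (Fin n)) (r : ℝ) :
    volume (S ∩ ball x r) / volume (ball x r) ≤ 1 :=
  ENNReal.div_le_of_le_mul (by simpa using measure_mono Set.inter_subset_right)

/-- Having density one at `x` only depends on the germ of the set at `x`, monotonically. -/
theorem HasLebesgueDensityOne.mono_of_eventually (hS : HasLebesgueDensityOne S x)
    (hST : ∀ᶠ y in 𝓝[S] x, y ∈ T) : HasLebesgueDensityOne T x := by
  obtain ⟨δ, hδ, hsub⟩ := Metric.mem_nhdsWithin_iff.1 hST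
  refine tendsto_of_tendsto_of_tendsto_of_le_of_le' hS tendsto_const_nhds ?_
    (Eventually.of_forall (volume_inter_ball_div_le_one T x))
  filter_upwards [Ioo_mem_nhdsGT hδ] with r hr
  refine ENNReal.div_le_div_right (measure_mono ?_) _
  exact fun y hy => ⟨hsub ⟨ball_subset_ball hr.2.le hy.2, hy.1⟩, hy.2⟩

theorem HasLebesgueDensityOne.inter (hS : HasLebesgueDensityOne S x)
    (hT : HasLebesgueDensityOne T x) (hTm : NullMeasurableSet T volume) :
    HasLebesgueDensityOne (S ∩ T) x := by
  have hlim := ENNReal.Tendsto.sub (hS.add hT)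
    (tendsto_const_nhds (x := (1 : ENNReal))) (Or.inr ENNReal.one_ne_top)
  rw [ENNReal.add_sub_cancel_right ENNReal.one_ne_top] at hlim
  refine tendsto_of_tendsto_of_tendsto_of_le_of_le' hlim tendsto_const_nhds ?_
    (Eventually.of_forall (volume_inter_ball_div_le_one _ x))
  filter_upwards [self_mem_nhdsWithin] with r hr
  have hpos : volume (ball x r) ≠ 0 := (measure_ball_pos volume x hr).ne'
  have htop : volume (ball x r) ≠ ⊤ := measure_ball_lt_top.ne
  rw [tsub_le_iff_right, ← ENNReal.div_self hpos htop, ← ENNReal.add_div, ← ENNReal.add_div,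
    ← measure_union_add_inter₀ (S ∩ ball x r)
      (hTm.inter measurableSet_ball.nullMeasurableSet), add_comm, ← Set.inter_inter_distrib_right]
  gcongr
  exact Set.union_subset Set.inter_subset_right Set.inter_subset_right

theorem ae_hasLebesgueDensityOne (S : Set (EuclideanSpace ℝ (Fin n))) :
    ∀ᵐ x ∂(volume.restrict S), HasLebesgueDensityOne S x := by
  filter_upwards [Besicovitch.ae_tendsto_measure_inter_div volume S] with x hx
  exact hasLebesgueDensityOne_iff_closedBall.2 hx

end Density

section LipschitzPieces

variable {X Y : Type*} [PseudoMetricSpace X] [PseudoMetricSpace Y]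

/-- The points of `E` in the `k`-th small ball around `c` at which `f` satisfies a linear bound
with constant `k` along `E`, at a scale at least the diameter of that ball. -/
def lipschitzPiece (E : Set X) (f : X → Y) (c : X) (k : ℕ) : Set X :=
  {x | x ∈ E ∧ dist x c < 1 / (k + 1) / 2 ∧
    ∀ y ∈ E, dist y x < 1 / (k + 1) → dist (f y) (f x) ≤ k * dist y x}

variable {E : Set X} {f : X → Y}

theorem lipschitzOnWith_lipschitzPiece (c : X) (k : ℕ) :
    LipschitzOnWith k f (lipschitzPiece E f c k) := by
  refine LipschitzOnWith.of_dist_le_mul fun x hx y hy => ?_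
  refine hy.2.2 x hx.1 ?_
  have := dist_triangle_right x y c
  linarith [hx.2.1, hy.2.1]

theorem measurableSet_lipschitzPiece [MeasurableSpace X] [BorelSpace X]
    (hE : MeasurableSet E) (c : X) (k : ℕ) : MeasurableSet (lipschitzPiece E f c k) := by
  have heq : lipschitzPiece E f c k =
      E ∩ closure (lipschitzPiece E f c k) ∩ ball c (1 / (k + 1) / 2) := by
    refine Set.Subset.antisymm (fun x hx => ⟨⟨hx.1, subset_closure hx⟩, hx.2.1⟩) ?_
    rintro x ⟨⟨hxE, hxcl⟩, hxb⟩
    refine ⟨hxE, hxb, fun y hy hyx => ?_⟩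
    obtain ⟨u, hu, hux⟩ := mem_closure_iff_seq_limit.1 hxcl
    have hfu : Tendsto (fun i => dist x (u i)) atTop (𝓝 0) := by
      simpa using (tendsto_const_nhds (x := x)).dist hux
    have hyu : Tendsto (fun i => dist y (u i)) atTop (𝓝 (dist y x)) :=
      tendsto_const_nhds.dist hux
    have hlim : Tendsto (fun i => k * dist y (u i) + k * dist x (u i)) atTop
        (𝓝 (k * dist y x + k * 0)) := (hyu.const_mul _).add (hfu.const_mul _)
    rw [mul_zero, add_zero] at hlim
    refine ge_of_tendsto hlim ?_
    filter_upwards [hyu.eventually_lt_const hyx,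
      hfu.eventually_lt_const (by positivity : (0 : ℝ) < 1 / (k + 1))] with i hyi hxi
    exact (dist_triangle_right _ _ _).trans
      (add_le_add ((hu i).2.2 y hy hyi) ((hu i).2.2 x hxE hxi))
  rw [heq]
  exact (hE.inter isClosed_closure.measurableSet).inter measurableSet_ball

theorem exists_mem_lipschitzPiece {d : ℕ → X} (hd : DenseRange d) {x : X} (hx : x ∈ E) {C : ℝ}
    (hC : ∀ᶠ y in 𝓝[E] x, dist (f y) (f x) ≤ C * dist y x) :
    ∃ j k, x ∈ lipschitzPiece E f (d j) k := by
  obtain ⟨δ, hδ, hsub⟩ := Metric.mem_nhdsWithin_iff.1 hC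
  obtain ⟨k₁, hk₁⟩ := exists_nat_one_div_lt hδ
  obtain ⟨k₂, hk₂⟩ := exists_nat_ge C
  obtain ⟨j, hj⟩ := hd.exists_dist_lt x
    (by positivity : (0 : ℝ) < 1 / ((max k₁ k₂ : ℕ) + 1) / 2)
  refine ⟨j, max k₁ k₂, hx, hj, fun y hy hyx => ?_⟩
  have hle : (1 : ℝ) / ((max k₁ k₂ : ℕ) + 1) ≤ 1 / (k₁ + 1) := by
    gcongr
    exact le_max_left _ _
  have hyδ : dist y x < δ := hyx.trans (hle.trans_lt hk₁)
  refine (show dist (f y) (f x) ≤ C * dist y x from hsub ⟨hyδ, hy⟩).trans ?_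
  gcongr
  exact hk₂.trans (by exact_mod_cast le_max_right _ _)

end LipschitzPieces

section ApproxFDeriv

variable {n m : ℕ} {E : Set (EuclideanSpace ℝ (Fin n))}
  {φ : EuclideanSpace ℝ (Fin n) → EuclideanSpace ℝ (Fin m)} {x : EuclideanSpace ℝ (Fin n)}

theorem HasFDerivWithinAt.isApproxFDerivOn {P : Set (EuclideanSpace ℝ (Fin n))}
    {A : EuclideanSpace ℝ (Fin n) →L[ℝ] EuclideanSpace ℝ (Fin m)}
    (hA : HasFDerivWithinAt φ A P x) (hPE : P ⊆ E) (hP : HasLebesgueDensityOne P x) :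
    IsApproxFDerivOn E φ x A := by
  intro ε hε
  refine hP.mono_of_eventually ?_
  filter_upwards [hA.isLittleO.def hε, self_mem_nhdsWithin] with y hy hyP
  exact ⟨hPE hyP, hy⟩

theorem nullMeasurableSet_norm_sub_sub_le (hE : MeasurableSet E)
    (hφ : AEMeasurable φ (volume.restrict E)) (x : EuclideanSpace ℝ (Fin n))
    (A : EuclideanSpace ℝ (Fin n) →ₗ[ℝ] EuclideanSpace ℝ (Fin m)) (ε : ℝ) :
    NullMeasurableSet {y | y ∈ E ∧ ‖φ y - φ x - A (y - x)‖ ≤ ε * ‖y - x‖} volume := by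
  have hA : Measurable fun y => A (y - x) :=
    (A.continuous_of_finiteDimensional.comp (continuous_sub_right x)).measurable
  have hle : NullMeasurableSet {y | ‖φ y - φ x - A (y - x)‖ ≤ ε * ‖y - x‖}
      (volume.restrict E) :=
    nullMeasurableSet_le ((hφ.sub_const _).sub hA.aemeasurable).norm (by fun_prop)
  have hinter := (nullMeasurableSet_restrict hE.nullMeasurableSet).1 hle
  rwa [Set.inter_comm] at hinter

theorem IsApproxFDerivOn.unique (hE : MeasurableSet E)
    (hφ : AEMeasurable φ (volume.restrict E))
    {A₁ A₂ : EuclideanSpace ℝ (Fin n) →ₗ[ℝ] EuclideanSpace ℝ (Fin m)}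
    (h₁ : IsApproxFDerivOn E φ x A₁) (h₂ : IsApproxFDerivOn E φ x A₂) : A₁ = A₂ := by
  by_contra hne
  obtain ⟨v, hv⟩ : ∃ v, (A₁ - A₂) v ≠ 0 := by
    by_contra! h
    exact hne (sub_eq_zero.1 (LinearMap.ext h))
  have hv0 : 0 < ‖v‖ := norm_pos_iff.2 fun h => hv (by rw [h, map_zero])
  set ε : ℝ := ‖(A₁ - A₂) v‖ / (4 * ‖v‖) with hε_def
  have hε : 0 < ε := div_pos (norm_pos_iff.2 hv) (by positivity)
  have hdens := (h₁ ε hε).inter (h₂ ε hε) (nullMeasurableSet_norm_sub_sub_le hE hφ x A₂ ε)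
  let cone : Set (EuclideanSpace ℝ (Fin n)) := {w | 2 * ε * ‖w‖ < ‖(A₁ - A₂) w‖}
  have hopen : IsOpen cone := isOpen_lt (by fun_prop)
    (A₁ - A₂).continuous_of_finiteDimensional.norm
  have hvmem : v ∈ cone := by
    have : ε * (4 * ‖v‖) = ‖(A₁ - A₂) v‖ := div_mul_cancel₀ _ (by positivity)
    change 2 * ε * ‖v‖ < ‖(A₁ - A₂) v‖
    nlinarith [mul_pos hε hv0]
  have hev := Measure.eventually_nonempty_inter_smul_of_density_one volume _ x
    (hasLebesgueDensityOne_iff_closedBall.1 hdens) cone hopen.measurableSet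
    (hopen.measure_pos volume ⟨v, hvmem⟩).ne'
  obtain ⟨r, ⟨y, ⟨hy₁, hy₂⟩, hycone⟩, hr⟩ := (hev.and self_mem_nhdsWithin).exists
  rw [Set.singleton_add, Set.mem_image] at hycone
  obtain ⟨_, ⟨w, hw, rfl⟩, rfl⟩ := hycone
  have hr : 0 < r := hr
  have hle₁ := hy₁.2
  have hle₂ := hy₂.2
  simp only [add_sub_cancel_left, map_smul, norm_smul, Real.norm_of_nonneg hr.le]
    at hle₁ hle₂
  have hw : 2 * ε * ‖w‖ < ‖A₁ w - A₂ w‖ := hw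
  have htri : r * ‖A₁ w - A₂ w‖ ≤ ε * (r * ‖w‖) + ε * (r * ‖w‖) := by
    calc r * ‖A₁ w - A₂ w‖ = ‖(φ (x + r • w) - φ x - r • A₂ w)
          - (φ (x + r • w) - φ x - r • A₁ w)‖ := by
          rw [sub_sub_sub_cancel_left, ← smul_sub, norm_smul, Real.norm_of_nonneg hr.le]
      _ ≤ _ := (norm_sub_le _ _).trans (add_le_add hle₂ hle₁)
  nlinarith [mul_lt_mul_of_pos_left hw hr]

end ApproxFDeriv

/-- Rademacher–Stepanov for measurable sets. Let `E ⊆ ℝⁿ` be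
Lebesgue measurable and let `φ : E → ℝᵐ` satisfy
`limsup_{y→x, y∈E} |φ(y) − φ(x)|/|y − x| < ∞` for a.e. `x ∈ E` (equivalently: an
eventual linear bound near `x` along `E`). Then for a.e. `x ∈ E` there is a linear map
`A : ℝⁿ → ℝᵐ` which is an approximate differential of `φ` at `x` relative to `E`;
moreover at every point `x ∈ E` at which `E` has Lebesgue density `1`, such a linear
map is unique. -/
theorem stmt11 {n m : ℕ}
    (E : Set (EuclideanSpace ℝ (Fin n))) (hE : MeasurableSet E)
    (φ : EuclideanSpace ℝ (Fin n) → EuclideanSpace ℝ (Fin m))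
    (hlip : ∀ᵐ x ∂(volume.restrict E),
      ∃ C : ℝ, ∀ᶠ y in 𝓝[E] x, ‖φ y - φ x‖ ≤ C * ‖y - x‖) :
    (∀ᵐ x ∂(volume.restrict E), ∃ A, IsApproxFDerivOn E φ x A) ∧
    (∀ x ∈ E, HasLebesgueDensityOne E x →
      ∀ A₁ A₂, IsApproxFDerivOn E φ x A₁ → IsApproxFDerivOn E φ x A₂ → A₁ = A₂) := by
  let P : ℕ × ℕ → Set (EuclideanSpace ℝ (Fin n)) := fun i =>
    lipschitzPiece E φ (TopologicalSpace.denseSeq _ i.1) i.2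
  have hPE : ∀ i, P i ⊆ E := fun i x hx => hx.1
  have hcover : E =ᵐ[volume] ⋃ i, P i := by
    refine EventuallyLE.antisymm ?_ (LE.le.eventuallyLE (Set.iUnion_subset hPE))
    filter_upwards [(ae_restrict_iff' hE).1 hlip] with x hx hxE
    obtain ⟨C, hC⟩ := hx hxE
    obtain ⟨j, k, hjk⟩ := exists_mem_lipschitzPiece (TopologicalSpace.denseRange_denseSeq _) hxE
      (f := φ) (C := C) (by simpa only [dist_eq_norm] using hC)
    exact Set.mem_iUnion.2 ⟨(j, k), hjk⟩
  constructor
  · rw [Measure.restrict_congr_set hcover, ae_restrict_iUnion_iff]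
    intro i
    filter_upwards [ae_hasLebesgueDensityOne (P i),
      (lipschitzOnWith_lipschitzPiece _ _).ae_differentiableWithinAt
        (measurableSet_lipschitzPiece hE _ _)] with x hx hdiff
    exact ⟨_, hdiff.hasFDerivWithinAt.isApproxFDerivOn (hPE i) hx⟩
  · have hφ : AEMeasurable φ (volume.restrict E) := by
      rw [Measure.restrict_congr_set hcover, aemeasurable_iUnion_iff]
      exact fun i => (lipschitzOnWith_lipschitzPiece _ _).continuousOn.aemeasurable
        (measurableSet_lipschitzPiece hE _ _)
    exact fun x _ _ A₁ A₂ h₁ h₂ => h₁.unique hE hφ h₂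
end

section
/- Let Ω̃ ⊆ X be open, let g : Ω̃ → [0,∞] be a locally μ-integrable Borel function, let ν be a Borel measure on Ω̃ finite on compact subsets of Ω̃, and let K ≥ 0. Suppose that ∫_{B(y,r)} g dμ ≤ K·ν(B(y,2r)) for every ball B(y,r) with B(y,2r) ⊆ Ω̃. Then g(y) ≤ K·C_D·limsup_{r→0⁺} ν(B(y,r))/μ(B(y,r)) for μ-almost every y ∈ Ω̃. -/
open MeasureTheory Metric Filter Topology NNReal ENNReal

/-- A measure satisfying the doubling inequality on open balls of every positive radius is uniformly
locally doubling. -/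
theorem isUnifLocDoublingMeasure_of_measure_ball_two_mul_le {X : Type*} [PseudoMetricSpace X]
    [MeasurableSpace X] {μ : Measure X} (C : ℝ≥0)
    (h : ∀ (x : X) (r : ℝ), 0 < r → μ (ball x (2 * r)) ≤ C * μ (ball x r)) :
    IsUnifLocDoublingMeasure μ := by
  refine ⟨⟨C * C, ?_⟩⟩
  filter_upwards [self_mem_nhdsWithin] with r (hr : 0 < r) x
  calc μ (closedBall x (2 * r)) ≤ μ (ball x (2 * (2 * r))) :=
        measure_mono (closedBall_subset_ball (by linarith))
    _ ≤ C * μ (ball x (2 * r)) := h x _ (by positivity)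
    _ ≤ C * (C * μ (ball x r)) := by gcongr; exact h x r hr
    _ ≤ ((C * C : ℝ≥0) : ℝ≥0∞) * μ (closedBall x r) := by
        rw [ENNReal.coe_mul, mul_assoc]
        gcongr
        exact ball_subset_closedBall

/-- The measure of an open ball is the limit of the measures of smaller concentric closed balls. -/
theorem tendsto_measure_closedBall_nhdsLT {X : Type*} [PseudoMetricSpace X] [MeasurableSpace X]
    (μ : Measure X) (x : X) (r : ℝ) :
    Tendsto (fun s => μ (closedBall x s)) (𝓝[<] r) (𝓝 (μ (ball x r))) := by
  obtain ⟨u, hu, hur, hlim⟩ := exists_seq_strictMono_tendsto r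
  have hUnion : ⋃ n, closedBall x (u n) = ball x r := by
    ext z
    simp only [Set.mem_iUnion, mem_closedBall, mem_ball]
    exact ⟨fun ⟨n, hn⟩ => hn.trans_lt (hur n),
      fun hz => ((hlim.eventually_const_lt hz).exists).imp fun _ => le_of_lt⟩
  have hmono : Monotone fun n => closedBall x (u n) :=
    fun _ _ hmn => closedBall_subset_closedBall (hu.monotone hmn)
  have hsup : Tendsto (fun n => μ (closedBall x (u n))) atTop (𝓝 (μ (ball x r))) :=
    hUnion ▸ tendsto_measure_iUnion_atTop hmono
  refine tendsto_order.2 ⟨fun a ha => ?_, fun a ha => ?_⟩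
  · obtain ⟨n, hn⟩ := (hsup.eventually_const_lt ha).exists
    filter_upwards [Ioo_mem_nhdsLT (hur n)] with s hs
    exact hn.trans_le (measure_mono (closedBall_subset_closedBall hs.1.le))
  · filter_upwards [self_mem_nhdsWithin] with s hs
    exact (measure_mono (closedBall_subset_ball hs)).trans_lt ha

/-- One half of the Lebesgue differentiation theorem on balls, without any integrability
assumption. -/
theorem ae_eventually_mul_measure_ball_le_lintegral {X : Type*} [MetricSpace X]
    [SecondCountableTopology X] [MeasurableSpace X] [BorelSpace X] (μ : Measure X)
    [IsLocallyFiniteMeasure μ] [IsUnifLocDoublingMeasure μ] {g : X → ℝ≥0∞} (hg : Measurable g) :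
    ∀ᵐ y ∂μ, ∀ a < g y, ∀ᶠ r in 𝓝[>] (0 : ℝ), a * μ (ball y r) ≤ ∫⁻ x in ball y r, g x ∂μ := by
  let f : ℕ → X → ℝ≥0∞ := fun n => (spanningSets μ n).indicator fun x => min (g x) n
  have hfm (n : ℕ) : Measurable (f n) :=
    (hg.min measurable_const).indicator (measurableSet_spanningSets μ n)
  have hfg (n : ℕ) : f n ≤ g := fun x =>
    (Set.indicator_le_self _ _ x).trans (min_le_left _ _)
  have hfint (n : ℕ) : ∫⁻ x, f n x ∂μ ≠ ∞ := by
    rw [lintegral_indicator (measurableSet_spanningSets μ n)]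
    refine ((lintegral_mono fun x => min_le_right _ _).trans_lt ?_).ne
    rw [setLIntegral_const]
    exact ENNReal.mul_lt_top (ENNReal.natCast_lt_top n) (measure_spanningSets_lt_top μ n)
  have hlim := ae_all_iff.2 fun n =>
    (IsUnifLocDoublingMeasure.vitaliFamily μ 1).ae_tendsto_lintegral_div (hfm n).aemeasurable
      (hfint n)
  filter_upwards [hlim] with y hy a ha
  obtain ⟨n, hyn, han⟩ : ∃ n : ℕ, y ∈ spanningSets μ n ∧ a < n := by
    obtain ⟨m, hm⟩ := ENNReal.exists_nat_gt ha.ne_top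
    refine ⟨max m (spanningSetsIndex μ y), ?_, hm.trans_le (by gcongr; exact le_max_left _ _)⟩
    exact monotone_spanningSets μ (le_max_right _ _) (mem_spanningSetsIndex μ y)
  have hlt : a < f n y := by
    simp only [f, Set.indicator_of_mem hyn]
    exact lt_min ha han
  have hcl : Tendsto (fun s : ℝ => closedBall y s) (𝓝[>] 0)
      ((IsUnifLocDoublingMeasure.vitaliFamily μ 1).filterAt y) :=
    IsUnifLocDoublingMeasure.tendsto_closedBall_filterAt μ (fun _ => y) id tendsto_id <| by
      filter_upwards [self_mem_nhdsWithin] with s (hs : 0 < s)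
      simpa using hs.le
  obtain ⟨δ, hδ, hδs⟩ := mem_nhdsGT_iff_exists_Ioo_subset.1
    (((hy n).comp hcl).eventually_const_lt hlt)
  filter_upwards [Ioo_mem_nhdsGT hδ] with r hr
  refine le_of_tendsto (ENNReal.Tendsto.const_mul (tendsto_measure_closedBall_nhdsLT μ y r)
    (.inr ha.ne_top)) ?_
  filter_upwards [Ioo_mem_nhdsLT hr.1] with s hs
  calc a * μ (closedBall y s) ≤ ∫⁻ x in closedBall y s, f n x ∂μ :=
        ENNReal.mul_le_of_le_div (hδs ⟨hs.1, hs.2.trans hr.2⟩).le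
    _ ≤ ∫⁻ x in ball y r, g x ∂μ := lintegral_mono'
        (Measure.restrict_mono (closedBall_subset_ball hs.2) le_rfl) (hfg n)

/-- Let `Ω̃ ⊆ X` be open, `g : Ω̃ → [0,∞]` a locally `μ`-integrable
Borel function, `ν` a Borel measure on `Ω̃` finite on compact subsets of `Ω̃`, and
`K ≥ 0`. Suppose `∫_{B(y,r)} g dμ ≤ K·ν(B(y,2r))` for every ball `B(y,r)` with
`B(y,2r) ⊆ Ω̃`. Then `g(y) ≤ K·C_D·limsup_{r→0⁺} ν(B(y,r))/μ(B(y,r))` for `μ`-almost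
every `y ∈ Ω̃`. -/
theorem stmt12
    {X : Type*} [MetricSpace X] [CompleteSpace X] [TopologicalSpace.SeparableSpace X]
    [MeasurableSpace X] [BorelSpace X] (μ : Measure X)
    (hpos : ∀ (x : X) (r : ℝ), 0 < r → 0 < μ (ball x r))
    (hfin : ∀ (x : X) (r : ℝ), μ (ball x r) < ⊤)
    (C_D : ℝ≥0) (hC_D : 1 ≤ C_D)
    (hdbl : ∀ (x : X) (r : ℝ), 0 < r → μ (ball x (2 * r)) ≤ (C_D : ℝ≥0∞) * μ (ball x r))
    (Ω' : Set X) (hΩ' : IsOpen Ω')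
    (g : X → ℝ≥0∞) (hg : Measurable g)
    (hgloc : ∀ K : Set X, K ⊆ Ω' → IsCompact K → (∫⁻ x in K, g x ∂μ) < ⊤)
    (ν : Measure X)
    (hν : ∀ K : Set X, K ⊆ Ω' → IsCompact K → ν K < ⊤)
    (K : ℝ≥0)
    (hball : ∀ (y : X) (r : ℝ), 0 < r → ball y (2 * r) ⊆ Ω' →
      (∫⁻ x in ball y r, g x ∂μ) ≤ (K : ℝ≥0∞) * ν (ball y (2 * r))) :
    ∀ᵐ y ∂(μ.restrict Ω'),
      g y ≤ (K : ℝ≥0∞) * (C_D : ℝ≥0∞) *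
        limsup (fun r : ℝ => ν (ball y r) / μ (ball y r)) (𝓝[>] 0) := by
  have := isUnifLocDoublingMeasure_of_measure_ball_two_mul_le C_D hdbl
  have : IsLocallyFiniteMeasure μ :=
    ⟨fun x => ⟨ball x 1, ball_mem_nhds x one_pos, hfin x 1⟩⟩
  have : SecondCountableTopology X := UniformSpace.secondCountable_of_separable X
  rw [ae_restrict_iff' hΩ'.measurableSet]
  filter_upwards [ae_eventually_mul_measure_ball_le_lintegral μ hg] with y hy hyΩ
  refine le_of_forall_lt_imp_le_of_dense fun a ha => ?_
  rw [← ENNReal.limsup_const_mul_of_ne_top (by finiteness)]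
  obtain ⟨ε, hε, hεΩ⟩ := Metric.isOpen_iff.1 hΩ' y hyΩ
  have hhalf : Tendsto (fun r : ℝ => r / 2) (𝓝[>] 0) (𝓝[>] 0) :=
    tendsto_nhdsWithin_iff.2 ⟨((continuous_id.div_const 2).tendsto' 0 0 (by simp)).mono_left
      nhdsWithin_le_nhds, by
      filter_upwards [self_mem_nhdsWithin] with r (hr : 0 < r) using half_pos hr⟩
  refine le_limsup_of_frequently_le (Eventually.frequently ?_) (by isBoundedDefault)
  filter_upwards [hhalf.eventually (hy a ha), Ioo_mem_nhdsGT hε] with r har hr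
  have h2 : 2 * (r / 2) = r := by ring
  have hr2 : 0 < r / 2 := half_pos hr.1
  have hint := hball y (r / 2) hr2
  have hd := hdbl y (r / 2) hr2
  rw [h2] at hint hd
  rw [← mul_div_assoc, ENNReal.le_div_iff_mul_le (.inl (hpos y r hr.1).ne') (.inl (hfin y r).ne)]
  calc a * μ (ball y r) ≤ a * (C_D * μ (ball y (r / 2))) := by gcongr
    _ = C_D * (a * μ (ball y (r / 2))) := by ring
    _ ≤ C_D * (K * ν (ball y r)) := by
        gcongr _ * ?_
        exact har.trans (hint ((ball_subset_ball hr.2.le).trans hεΩ))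
    _ = K * C_D * ν (ball y r) := by ring
end

section
/- Let φ : Ω → Ω̃ be a homeomorphism between open subsets of ℝⁿ. Then φ is measurable in the sense of Zaanen, i.e. φ⁻¹(A) is Lebesgue measurable for every Lebesgue measurable set A ⊆ Ω̃, if and only if φ has the Luzin N⁻¹-property, i.e. φ⁻¹(A) has Lebesgue measure zero for every set A ⊆ Ω̃ of Lebesgue measure zero. -/
open MeasureTheory Metric Filter Topology

/-- In a nontrivial finite-dimensional real space, a set all of whose subsets are Haar
null-measurable is itself null. -/
theorem measure_eq_zero_of_forall_subset_nullMeasurableSet {E : Type*} [NormedAddCommGroup E]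
    [NormedSpace ℝ E] [FiniteDimensional ℝ E] [Nontrivial E] [MeasurableSpace E] [BorelSpace E]
    (μ : Measure E) [μ.IsAddHaarMeasure] {S : Set E}
    (hS : ∀ W ⊆ S, NullMeasurableSet W μ) : μ S = 0 := by
  obtain ⟨v, hv⟩ := exists_ne (0 : E)
  let f : ℚ →+ E := (LinearMap.toSpanSingleton ℝ E v).toAddMonoidHom.comp
    (Rat.castHom ℝ).toAddMonoidHom
  have hf (q : ℚ) : f q = (q : ℝ) • v := rfl
  let r : E → E := fun x ↦ (QuotientAddGroup.mk x : E ⧸ f.range).out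
  have hr (x : E) : ∃ q : ℚ, x = r x + f q := by
    have h : (QuotientAddGroup.mk (r x) : E ⧸ f.range) = QuotientAddGroup.mk x :=
      Quotient.out_eq' _
    obtain ⟨q, hq⟩ := QuotientAddGroup.eq.1 h
    exact ⟨q, by rw [hq, add_neg_cancel_left]⟩
  have hcover : S ⊆ ⋃ q : ℚ, {x ∈ S | x = r x + f q} := fun x hx ↦ by
    obtain ⟨q, hq⟩ := hr x
    exact Set.mem_iUnion.2 ⟨q, hx, hq⟩
  refine measure_mono_null hcover (measure_iUnion_null fun q ↦ ?_)
  by_contra hpos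
  obtain ⟨B, hBW, hBm, hB⟩ :=
    (hS {x ∈ S | x = r x + f q} fun _ hx ↦ hx.1).exists_measurable_subset_ae_eq
  have hBpos : 0 < μ B := by
    rw [measure_congr hB]
    exact pos_iff_ne_zero.2 hpos
  have hnhds := Measure.sub_mem_nhds_zero_of_addHaar_pos μ B hBm hBpos
  have hlim : Tendsto (fun k : ℕ ↦ f (1 / ((k : ℚ) + 1))) atTop (𝓝 0) := by
    have h := (tendsto_one_div_add_atTop_nhds_zero_nat (𝕜 := ℝ)).smul_const v
    simpa [hf] using h
  obtain ⟨k, x, hx, y, hy, hxy⟩ := (hlim.eventually hnhds).exists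
  have hrxy : r x = r y := by
    have h : (QuotientAddGroup.mk y : E ⧸ f.range) = QuotientAddGroup.mk x :=
      QuotientAddGroup.eq.2 ⟨1 / ((k : ℚ) + 1), by rw [← hxy, neg_add_eq_sub]⟩
    simp only [r, h]
  have hx_eq : x = y := by rw [(hBW hx).2, (hBW hy).2, hrxy]
  have hne : f (1 / ((k : ℚ) + 1)) ≠ 0 := by
    rw [hf]
    refine smul_ne_zero ?_ hv
    exact_mod_cast (by positivity : (1 / ((k : ℚ) + 1)) ≠ 0)
  exact hne (by rw [← hxy, hx_eq]; simp)

/-- Let `φ : Ω → Ω̃` be a homeomorphism between open subsets of `ℝⁿ`.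
Then `φ` is measurable in the sense of Zaanen — `φ⁻¹(A)` is Lebesgue measurable (i.e.
null-measurable for the completed Borel σ-algebra) for every Lebesgue measurable
`A ⊆ Ω̃` — if and only if `φ` has the Luzin N⁻¹-property: `φ⁻¹(A)` has Lebesgue measure
zero for every `A ⊆ Ω̃` of Lebesgue measure zero. -/
theorem stmt13 {n : ℕ}
    (Ω Ω' : Set (EuclideanSpace ℝ (Fin n))) (hΩ : IsOpen Ω) (hΩ' : IsOpen Ω')
    (φ : EuclideanSpace ℝ (Fin n) → EuclideanSpace ℝ (Fin n))
    (hmaps : Set.MapsTo φ Ω Ω') (hinj : Set.InjOn φ Ω) (hsurj : φ '' Ω = Ω')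
    (hcont : ContinuousOn φ Ω)
    (hopenmap : ∀ U : Set (EuclideanSpace ℝ (Fin n)), U ⊆ Ω → IsOpen U → IsOpen (φ '' U)) :
    (∀ A : Set (EuclideanSpace ℝ (Fin n)), A ⊆ Ω' →
        NullMeasurableSet A volume → NullMeasurableSet (φ ⁻¹' A ∩ Ω) volume) ↔
    (∀ A : Set (EuclideanSpace ℝ (Fin n)), A ⊆ Ω' →
        volume A = 0 → volume (φ ⁻¹' A ∩ Ω) = 0) := by
  constructor
  · intro h A hA hA0
    rcases Nat.eq_zero_or_pos n with rfl | hn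
    · have hempty : A = ∅ := by
        by_contra hne
        rw [Subsingleton.eq_univ_of_nonempty (Set.nonempty_iff_ne_empty.2 hne)] at hA0
        exact (isOpen_univ.measure_pos volume Set.univ_nonempty).ne' hA0
      simp [hempty]
    · have : NeZero n := ⟨hn.ne'⟩
      refine measure_eq_zero_of_forall_subset_nullMeasurableSet volume fun W hW ↦ ?_
      have hWA : φ '' W ⊆ A := Set.image_subset_iff.2 fun x hx ↦ (hW hx).1
      have hpre : φ ⁻¹' (φ '' W) ∩ Ω = W := by
        ext x
        constructor
        · rintro ⟨⟨y, hy, hyx⟩, hx⟩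
          exact hinj (hW hy).2 hx hyx ▸ hy
        · exact fun hx ↦ ⟨⟨x, hx, rfl⟩, (hW hx).2⟩
      rw [← hpre]
      exact h _ (hWA.trans hA) (NullMeasurableSet.of_null (measure_mono_null hWA hA0))
  · intro h A hA hAm
    obtain ⟨B, hBA, hBm, hB⟩ := hAm.exists_measurable_subset_ae_eq
    have hsplit : φ ⁻¹' A ∩ Ω = (φ ⁻¹' B ∩ Ω) ∪ (φ ⁻¹' (A \ B) ∩ Ω) := by
      rw [← Set.union_inter_distrib_right, ← Set.preimage_union, Set.union_sdiff_cancel hBA]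
    have hpreB : MeasurableSet (φ ⁻¹' B ∩ Ω) := by
      have hm : MeasurableSet (Ω.domRestrict φ ⁻¹' B) := hcont.domRestrict.measurable hBm
      have himg := hΩ.measurableSet.subtype_image hm
      rwa [Set.domRestrict_eq, Set.preimage_comp, Subtype.image_preimage_coe, Set.inter_comm] at himg
    rw [hsplit]
    exact hpreB.nullMeasurableSet.union (NullMeasurableSet.of_null
      (h _ (Set.sdiff_subset.trans hA) (ae_le_set.1 hB.symm.le)))
end
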